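/- arXiv:math/0405400 — 6 statements merged into one kernel-verified Lean document; each statement's English description precedes it below -/
import Mathlib

section
/- Let R be a commutative ring with identity. Then the set of sequences (x_n)_{n≥1} with entries in R, equipped with componentwise addition and with the multiplication whose n-th component is (x·y)_n = ∑_{lcm(i,j)=n} gcd(i,j)·x_i·y_j (the sum ranging over all ordered pairs of positive integers i, j with lcm(i,j) = n), is a commutative ring. -/
open Finset

/-- The finite set of ordered pairs `(i, j)` of positive integers with `lcm i j = n`. -/
def lcmPairs (n : ℕ) : Finset (ℕ × ℕ) :=
  (n.divisors ×ˢ n.divisors).filter fun p => Nat.lcm p.1 p.2 = n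

/-- Extend a sequence indexed by positive integers to all of `ℕ` by `0`. -/
def seqExt {R : Type*} [Zero R] (x : ℕ+ → R) : ℕ → R :=
  fun n => if h : 0 < n then x ⟨n, h⟩ else 0

lemma lcmPairs_zero : lcmPairs 0 = ∅ := by simp [lcmPairs]

/-- The necklace product of two sequences indexed by `ℕ`; its value at `0` is `0`. -/
def necklaceMul {R : Type*} [CommRing R] (x y : ℕ → R) (n : ℕ) : R :=
  ∑ p ∈ lcmPairs n, (Nat.gcd p.1 p.2 : R) * x p.1 * y p.2

section necklaceMul

variable {R : Type*} [CommRing R]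

lemma necklaceMul_zero (x y : ℕ → R) : necklaceMul x y 0 = 0 := by
  simp [necklaceMul, lcmPairs_zero]

/-- The necklace product as a sum over the divisors of any nonzero multiple of the index. -/
lemma necklaceMul_eq_sum_divisors (x y : ℕ → R) {n N : ℕ} (hN : N ≠ 0) (h : n ∣ N) :
    necklaceMul x y n = ∑ a ∈ N.divisors, ∑ b ∈ N.divisors,
      if Nat.lcm a b = n then (Nat.gcd a b : R) * x a * y b else 0 := by
  rw [← Finset.sum_product', ← Finset.sum_filter, necklaceMul]
  refine Finset.sum_congr ?_ fun _ _ => rfl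
  ext ⟨a, b⟩
  simp only [lcmPairs, mem_filter, mem_product, Nat.mem_divisors]
  constructor
  · rintro ⟨⟨⟨ha, _⟩, hb, _⟩, hab⟩
    exact ⟨⟨⟨ha.trans h, hN⟩, hb.trans h, hN⟩, hab⟩
  · rintro ⟨_, rfl⟩
    have h0 : Nat.lcm a b ≠ 0 := ne_zero_of_dvd_ne_zero hN h
    exact ⟨⟨⟨Nat.dvd_lcm_left a b, h0⟩, Nat.dvd_lcm_right a b, h0⟩, rfl⟩

lemma necklaceMul_comm (x y : ℕ → R) : necklaceMul x y = necklaceMul y x := by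
  funext n
  rcases eq_or_ne n 0 with rfl | hn
  · simp only [necklaceMul_zero]
  rw [necklaceMul_eq_sum_divisors x y hn dvd_rfl, necklaceMul_eq_sum_divisors y x hn dvd_rfl,
    Finset.sum_comm]
  refine Finset.sum_congr rfl fun a _ => Finset.sum_congr rfl fun b _ => ?_
  rw [Nat.lcm_comm, Nat.gcd_comm, mul_right_comm]

lemma necklaceMul_necklaceMul (x y z : ℕ → R) {n : ℕ} (hn : n ≠ 0) :
    necklaceMul (necklaceMul x y) z n =
      ∑ a ∈ n.divisors, ∑ b ∈ n.divisors, ∑ c ∈ n.divisors,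
        if Nat.lcm (Nat.lcm a b) c = n then
          ((Nat.gcd (Nat.lcm a b) c * Nat.gcd a b : ℕ) : R) * x a * y b * z c else 0 := by
  rw [necklaceMul_eq_sum_divisors _ z hn dvd_rfl]
  have key : ∀ k ∈ n.divisors, (∑ c ∈ n.divisors,
      if Nat.lcm k c = n then (Nat.gcd k c : R) * necklaceMul x y k * z c else 0) =
      ∑ a ∈ n.divisors, ∑ b ∈ n.divisors, if Nat.lcm a b = k then
        ∑ c ∈ n.divisors, (if Nat.lcm (Nat.lcm a b) c = n then
          ((Nat.gcd (Nat.lcm a b) c * Nat.gcd a b : ℕ) : R) * x a * y b * z c else 0) else 0 := by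
    intro k hk
    have expand : ∀ c ∈ n.divisors,
        (if Nat.lcm k c = n then (Nat.gcd k c : R) * necklaceMul x y k * z c else 0) =
        ∑ a ∈ n.divisors, ∑ b ∈ n.divisors, if Nat.lcm a b = k then
          (if Nat.lcm (Nat.lcm a b) c = n then
          ((Nat.gcd (Nat.lcm a b) c * Nat.gcd a b : ℕ) : R) * x a * y b * z c else 0) else 0 := by
      intro c _
      have push : ∀ (P : Prop) [Decidable P] (f : ℕ → R),
          (if P then ∑ a ∈ n.divisors, f a else 0) = ∑ a ∈ n.divisors, if P then f a else 0 := by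
        intro P _ f
        split_ifs <;> simp
      simp only [necklaceMul_eq_sum_divisors x y hn (Nat.dvd_of_mem_divisors hk), Finset.mul_sum,
        Finset.sum_mul, push]
      refine Finset.sum_congr rfl fun a _ => Finset.sum_congr rfl fun b _ => ?_
      by_cases hab : Nat.lcm a b = k
      · subst hab
        simp only [if_true]
        congr 1
        push_cast
        ring
      · simp [hab]
    rw [Finset.sum_congr rfl expand, Finset.sum_comm]
    refine Finset.sum_congr rfl fun a _ => ?_
    rw [Finset.sum_comm]
    refine Finset.sum_congr rfl fun b _ => ?_
    split_ifs <;> simp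
  rw [Finset.sum_congr rfl key, Finset.sum_comm]
  refine Finset.sum_congr rfl fun a ha => ?_
  rw [Finset.sum_comm]
  refine Finset.sum_congr rfl fun b hb => ?_
  rw [Finset.sum_ite_eq, if_pos]
  exact Nat.mem_divisors.2
    ⟨Nat.lcm_dvd (Nat.dvd_of_mem_divisors ha) (Nat.dvd_of_mem_divisors hb), hn⟩

lemma gcd_lcm_mul_gcd_rotate {a b c : ℕ} (ha : a ≠ 0) (hb : b ≠ 0) (hc : c ≠ 0) :
    Nat.gcd (Nat.lcm a b) c * Nat.gcd a b = Nat.gcd (Nat.lcm b c) a * Nat.gcd b c := by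
  have h : ∀ a b c : ℕ, Nat.gcd (Nat.lcm a b) c * Nat.gcd a b * Nat.lcm (Nat.lcm a b) c =
      a * b * c := by
    intro a b c
    rw [mul_right_comm, Nat.gcd_mul_lcm, mul_right_comm, mul_comm (Nat.lcm a b),
      Nat.gcd_mul_lcm]
  refine Nat.eq_of_mul_eq_mul_right
    (Nat.pos_of_ne_zero (Nat.lcm_ne_zero (Nat.lcm_ne_zero ha hb) hc)) ?_
  rw [h, Nat.lcm_assoc, Nat.lcm_comm a, h]
  ring

lemma necklaceMul_assoc (x y z : ℕ → R) :
    necklaceMul (necklaceMul x y) z = necklaceMul x (necklaceMul y z) := by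
  funext n
  rcases eq_or_ne n 0 with rfl | hn
  · simp only [necklaceMul_zero]
  rw [necklaceMul_comm x (necklaceMul y z), necklaceMul_necklaceMul x y z hn, necklaceMul_necklaceMul y z x hn,
    Finset.sum_comm]
  conv_rhs => enter [2, b]; rw [Finset.sum_comm]
  refine Finset.sum_congr rfl fun b hb => Finset.sum_congr rfl fun a ha =>
    Finset.sum_congr rfl fun c hc => ?_
  rw [gcd_lcm_mul_gcd_rotate (Nat.pos_of_mem_divisors ha).ne' (Nat.pos_of_mem_divisors hb).ne'
    (Nat.pos_of_mem_divisors hc).ne', Nat.lcm_assoc, Nat.lcm_comm a]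
  congr 1
  ring

lemma necklaceMul_add (x y z : ℕ → R) :
    necklaceMul x (y + z) = necklaceMul x y + necklaceMul x z := by
  funext n
  simp [necklaceMul, mul_add, Finset.sum_add_distrib]

lemma one_necklaceMul (x : ℕ → R) {n : ℕ} (hn : n ≠ 0) :
    necklaceMul (Pi.single 1 1) x n = x n := by
  rw [necklaceMul, Finset.sum_eq_single (1, n)]
  · simp
  · rintro ⟨a, b⟩ hp hne
    have ha : a ≠ 1 := by
      rintro rfl
      simp [lcmPairs] at hp
      exact hne (by rw [hp.2])
    simp [ha]
  · intro h
    simp [lcmPairs, hn] at h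

end necklaceMul

section seqExt

variable {R : Type*} [CommRing R]

lemma seqExt_coe (x : ℕ+ → R) (n : ℕ+) : seqExt x n = x n :=
  dif_pos n.pos

lemma seqExt_zero (x : ℕ+ → R) : seqExt x 0 = 0 :=
  dif_neg (lt_irrefl 0)

lemma seqExt_add (x y : ℕ+ → R) : seqExt (x + y) = seqExt x + seqExt y := by
  funext n
  rcases Nat.eq_zero_or_pos n with rfl | h
  · simp only [Pi.add_apply, seqExt_zero, add_zero]
  · lift n to ℕ+ using h
    simp only [Pi.add_apply, seqExt_coe]

lemma seqExt_single_one : seqExt (Pi.single 1 1 : ℕ+ → R) = Pi.single 1 1 := by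
  funext n
  rcases Nat.eq_zero_or_pos n with rfl | h
  · simp [seqExt_zero]
  · lift n to ℕ+ using h
    simp only [seqExt_coe, Pi.single_apply, PNat.coe_eq_one_iff]

lemma seqExt_necklaceMul (x y : ℕ → R) :
    seqExt (fun n : ℕ+ => necklaceMul x y n) = necklaceMul x y := by
  funext n
  rcases Nat.eq_zero_or_pos n with rfl | h
  · rw [seqExt_zero, necklaceMul_zero]
  · lift n to ℕ+ using h
    rw [seqExt_coe]

end seqExt

/-- The necklace product of two sequences indexed by the positive integers. -/
def pnatNecklaceMul {R : Type*} [CommRing R] (x y : ℕ+ → R) : ℕ+ → R :=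
  fun n => necklaceMul (seqExt x) (seqExt y) n

section pnatNecklaceMul

variable {R : Type*} [CommRing R]

lemma pnatNecklaceMul_comm (x y : ℕ+ → R) : pnatNecklaceMul x y = pnatNecklaceMul y x := by
  unfold pnatNecklaceMul
  rw [necklaceMul_comm]

lemma pnatNecklaceMul_assoc (x y z : ℕ+ → R) :
    pnatNecklaceMul (pnatNecklaceMul x y) z = pnatNecklaceMul x (pnatNecklaceMul y z) := by
  unfold pnatNecklaceMul
  rw [seqExt_necklaceMul, seqExt_necklaceMul, necklaceMul_assoc]

lemma pnatNecklaceMul_add (x y z : ℕ+ → R) :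
    pnatNecklaceMul x (y + z) = pnatNecklaceMul x y + pnatNecklaceMul x z := by
  funext n
  simp only [pnatNecklaceMul, seqExt_add, necklaceMul_add, Pi.add_apply]

lemma add_pnatNecklaceMul (x y z : ℕ+ → R) :
    pnatNecklaceMul (x + y) z = pnatNecklaceMul x z + pnatNecklaceMul y z := by
  simp only [pnatNecklaceMul_comm _ z, pnatNecklaceMul_add]

lemma pnatNecklaceMul_zero (x : ℕ+ → R) : pnatNecklaceMul x 0 = 0 := by
  have h := pnatNecklaceMul_add x 0 0
  rwa [add_zero, left_eq_add] at h

lemma one_pnatNecklaceMul (x : ℕ+ → R) : pnatNecklaceMul (Pi.single 1 1) x = x := by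
  funext n
  simp only [pnatNecklaceMul, seqExt_single_one, one_necklaceMul _ n.ne_zero, seqExt_coe]

end pnatNecklaceMul

/-- The type of sequences indexed by the positive integers, as carrier of the necklace ring. -/
def NecklaceRing (R : Type*) : Type _ := ℕ+ → R

instance (R : Type*) [CommRing R] : AddCommGroup (NecklaceRing R) :=
  inferInstanceAs (AddCommGroup (ℕ+ → R))

instance (R : Type*) [CommRing R] : CommRing (NecklaceRing R) where
  mul := pnatNecklaceMul
  one := (Pi.single 1 1 : ℕ+ → R)
  mul_assoc := pnatNecklaceMul_assoc
  mul_comm := pnatNecklaceMul_comm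
  one_mul := one_pnatNecklaceMul
  mul_one x := (pnatNecklaceMul_comm x _).trans (one_pnatNecklaceMul x)
  left_distrib := pnatNecklaceMul_add
  right_distrib := add_pnatNecklaceMul
  mul_zero := pnatNecklaceMul_zero
  zero_mul x := (pnatNecklaceMul_comm 0 x).trans (pnatNecklaceMul_zero x)
  neg_add_cancel := neg_add_cancel
  zsmul := (· • ·)
  zsmul_zero' := zero_zsmul
  zsmul_succ' n x := SubNegMonoid.zsmul_succ' n x
  zsmul_neg' n x := SubNegMonoid.zsmul_neg' n x
  sub_eq_add_neg := sub_eq_add_neg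

/-- The necklace ring `Nr(R)`: the sequences `(x_n)_{n ≥ 1}` with entries in `R`, with
componentwise addition and multiplication
`(x·y)_n = ∑_{lcm(i,j)=n} gcd(i,j)·x_i·y_j`, form a commutative ring. -/
theorem necklace_ring_exists (R : Type*) [CommRing R] :
    ∃ inst : CommRing (ℕ+ → R),
      (∀ x y : ℕ+ → R, ∀ n : ℕ+, inst.add x y n = x n + y n) ∧
      (∀ x y : ℕ+ → R, ∀ n : ℕ+, inst.mul x y n =
        ∑ p ∈ lcmPairs (n : ℕ),
          (Nat.gcd p.1 p.2 : R) * seqExt x p.1 * seqExt y p.2) := by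
  exact ⟨(inferInstance : CommRing (NecklaceRing R)), fun _ _ _ => rfl, fun _ _ _ => rfl⟩
end

section
/- Let R be a commutative ring containing ℚ as a subring. For sequences a, b : {positive integers} → R let (ab)_n = a_n·b_n denote the pointwise product, and for n ≥ 1 set M̃(a,n) = (1/n)·∑_{d|n} μ(d)·a_{n/d}. Then for every positive integer n, M̃(ab, n) = ∑_{lcm(i,j)=n} gcd(i,j)·M̃(a,i)·M̃(b,j). -/
open Finset ArithmeticFunction

/-- `M̃(a,n) = (1/n)·∑_{d|n} μ(d)·a_{n/d}` in a ring containing `ℚ`. -/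
noncomputable def Mtilde {R : Type*} [CommRing R] [Algebra ℚ R] (a : ℕ → R) (n : ℕ) : R :=
  algebraMap ℚ R (1 / (n : ℚ)) *
    ∑ d ∈ n.divisors, ((moebius d : ℤ) : R) * a (n / d)

/-- The von Sterneck convolution identity: summing over pairs with lcm `d`, for `d ∣ n`, is
summing over pairs of divisors of `n`. -/
theorem sum_divisors_sum_lcmPairs {R : Type*} [CommRing R] (f g : ℕ → R) {n : ℕ} (hn : 0 < n) :
    ∑ d ∈ n.divisors, ∑ p ∈ lcmPairs d, f p.1 * g p.2 =
      (∑ i ∈ n.divisors, f i) * ∑ j ∈ n.divisors, g j := by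
  rw [sum_mul_sum, ← sum_product', ← sum_fiberwise_of_maps_to (t := n.divisors)
    (g := fun p : ℕ × ℕ => Nat.lcm p.1 p.2)]
  · refine sum_congr rfl fun d hd => sum_congr ?_ fun _ _ => rfl
    have hdn := Nat.dvd_of_mem_divisors hd
    have hd0 := (Nat.pos_of_mem_divisors hd).ne'
    ext ⟨i, j⟩
    simp only [lcmPairs, mem_filter, mem_product, Nat.mem_divisors]
    constructor
    · rintro ⟨⟨⟨hi, _⟩, hj, _⟩, h⟩
      exact ⟨⟨⟨hi.trans hdn, hn.ne'⟩, hj.trans hdn, hn.ne'⟩, h⟩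
    · rintro ⟨_, rfl⟩
      exact ⟨⟨⟨Nat.dvd_lcm_left i j, hd0⟩, Nat.dvd_lcm_right i j, hd0⟩, rfl⟩
  · rintro ⟨i, j⟩ h
    simp only [mem_product, Nat.mem_divisors] at h ⊢
    exact ⟨Nat.lcm_dvd h.1.1 h.2.1, hn.ne'⟩

section Mtilde

variable {R : Type*} [CommRing R] [Algebra ℚ R]

theorem algebraMap_one_div_mul_natCast {n : ℕ} (hn : 0 < n) :
    algebraMap ℚ R (1 / (n : ℚ)) * (n : R) = 1 := by
  rw [← map_natCast (algebraMap ℚ R) n, ← map_mul, one_div_mul_cancel (by positivity), map_one]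

theorem natCast_mul_Mtilde (a : ℕ → R) {n : ℕ} (hn : 0 < n) :
    (n : R) * Mtilde a n =
      ∑ x ∈ n.divisorsAntidiagonal, ((moebius x.1 : ℤ) : R) * a x.2 := by
  rw [Mtilde, ← mul_assoc, mul_comm (n : R), algebraMap_one_div_mul_natCast hn, one_mul,
    Nat.sum_divisorsAntidiagonal fun d e => ((moebius d : ℤ) : R) * a e]

/-- `Mtilde` inverts the ghost map. -/
theorem sum_divisors_natCast_mul_Mtilde (a : ℕ → R) {n : ℕ} (hn : 0 < n) :
    ∑ d ∈ n.divisors, (d : R) * Mtilde a d = a n :=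
  sum_eq_iff_sum_mul_moebius_eq.2 (fun _ hm => (natCast_mul_Mtilde a hm).symm) n hn

end Mtilde

/-- For a commutative ring `R` containing `ℚ` as a subring, and sequences `a, b` with
pointwise product `(ab)_n = a_n·b_n`, one has
`M̃(ab, n) = ∑_{lcm(i,j)=n} gcd(i,j)·M̃(a,i)·M̃(b,j)` for every `n ≥ 1`. -/
theorem Mtilde_mul (R : Type*) [CommRing R] [Algebra ℚ R]
    (a b : ℕ → R) (n : ℕ) (hn : 0 < n) :
    Mtilde (fun k => a k * b k) n =
      ∑ p ∈ lcmPairs n, (Nat.gcd p.1 p.2 : R) * Mtilde a p.1 * Mtilde b p.2 := by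
  have hS : (n : R) * Mtilde (fun k => a k * b k) n =
      ∑ p ∈ lcmPairs n, ((p.1 : R) * Mtilde a p.1) * ((p.2 : R) * Mtilde b p.2) := by
    rw [natCast_mul_Mtilde _ hn]
    refine sum_eq_iff_sum_mul_moebius_eq (f := fun m => ∑ p ∈ lcmPairs m,
      ((p.1 : R) * Mtilde a p.1) * ((p.2 : R) * Mtilde b p.2))
      (g := fun k => a k * b k) |>.1 (fun m hm => ?_) n hn
    rw [sum_divisors_sum_lcmPairs (fun i => (i : R) * Mtilde a i)
      (fun j => (j : R) * Mtilde b j) hm, sum_divisors_natCast_mul_Mtilde a hm,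
      sum_divisors_natCast_mul_Mtilde b hm]
  have hT : (n : R) * Mtilde (fun k => a k * b k) n =
      (n : R) * ∑ p ∈ lcmPairs n, (Nat.gcd p.1 p.2 : R) * Mtilde a p.1 * Mtilde b p.2 := by
    rw [hS, mul_sum]
    refine sum_congr rfl fun p hp => ?_
    have hlcm : (Nat.gcd p.1 p.2 : R) * (n : R) = p.1 * p.2 := by
      rw [← (mem_filter.1 hp).2]
      exact_mod_cast congrArg (Nat.cast : ℕ → R) (Nat.gcd_mul_lcm p.1 p.2)
    linear_combination -(Mtilde a p.1 * Mtilde b p.2) * hlcm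
  simpa only [← mul_assoc, algebraMap_one_div_mul_natCast hn, one_mul] using
    congrArg (algebraMap ℚ R (1 / (n : ℚ)) * ·) hT
end

section
/- Let R be a commutative ring with identity. For sequences a, b : {positive integers} → R let (ab)_n = a_n·b_n denote the pointwise product, and for n ≥ 1 set S̃(a,n) = ∑_{d|n} μ(d)·a_{n/d}. Then for every positive integer n, S̃(ab, n) = ∑_{lcm(i,j)=n} S̃(a,i)·S̃(b,j). -/
open Finset ArithmeticFunction

/-- `S̃(a,n) = ∑_{d|n} μ(d)·a_{n/d}`. -/
def Stilde {R : Type*} [CommRing R] (a : ℕ → R) (n : ℕ) : R :=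
  ∑ d ∈ n.divisors, ((moebius d : ℤ) : R) * a (n / d)

theorem Stilde_eq_of_sum_divisors {R : Type*} [CommRing R] {f g : ℕ → R}
    (h : ∀ n > 0, ∑ d ∈ n.divisors, f d = g n) {n : ℕ} (hn : 0 < n) : Stilde g n = f n := by
  rw [← sum_eq_iff_sum_mul_moebius_eq.mp h n hn]
  exact (Nat.sum_divisorsAntidiagonal fun d e => ((moebius d : ℤ) : R) * g e).symm

theorem sum_divisors_Stilde {R : Type*} [CommRing R] (a : ℕ → R) {n : ℕ} (hn : 0 < n) :
    ∑ d ∈ n.divisors, Stilde a d = a n :=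
  sum_eq_iff_sum_mul_moebius_eq.mpr
    (fun _ _ => Nat.sum_divisorsAntidiagonal fun d e => ((moebius d : ℤ) : R) * a e) n hn

theorem sum_divisors_sum_lcmPairs_s8 {M : Type*} [AddCommMonoid M] (F : ℕ × ℕ → M) {n : ℕ}
    (hn : 0 < n) :
    ∑ d ∈ n.divisors, ∑ p ∈ lcmPairs d, F p = ∑ p ∈ n.divisors ×ˢ n.divisors, F p := by
  have hmaps : ∀ p ∈ n.divisors ×ˢ n.divisors, Nat.lcm p.1 p.2 ∈ n.divisors := by
    intro p hp
    simp only [mem_product, Nat.mem_divisors] at hp ⊢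
    exact ⟨Nat.lcm_dvd hp.1.1 hp.2.1, hn.ne'⟩
  rw [← sum_fiberwise_of_maps_to hmaps F]
  refine sum_congr rfl fun d hd => sum_congr ?_ fun _ _ => rfl
  have hdn := Nat.dvd_of_mem_divisors hd
  have hd0 := (Nat.pos_of_mem_divisors hd).ne'
  ext p
  simp only [lcmPairs, mem_filter, mem_product, Nat.mem_divisors]
  refine and_congr_left fun hp => ?_
  have h1 : p.1 ∣ d := hp ▸ Nat.dvd_lcm_left p.1 p.2
  have h2 : p.2 ∣ d := hp ▸ Nat.dvd_lcm_right p.1 p.2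
  simp [h1, h2, hd0, hn.ne', h1.trans hdn, h2.trans hdn]

/-- For any commutative ring `R`, sequences `a, b` with pointwise product
`(ab)_n = a_n·b_n`, and every `n ≥ 1`,
`S̃(ab, n) = ∑_{lcm(i,j)=n} S̃(a,i)·S̃(b,j)`. -/
theorem Stilde_mul (R : Type*) [CommRing R] (a b : ℕ → R) (n : ℕ) (hn : 0 < n) :
    Stilde (fun k => a k * b k) n =
      ∑ p ∈ lcmPairs n, Stilde a p.1 * Stilde b p.2 := by
  refine Stilde_eq_of_sum_divisors (f := fun m => ∑ p ∈ lcmPairs m, Stilde a p.1 * Stilde b p.2)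
    (fun m hm => ?_) hn
  rw [sum_divisors_sum_lcmPairs_s8 (fun p => Stilde a p.1 * Stilde b p.2) hm, sum_product,
    ← sum_mul_sum, sum_divisors_Stilde a hm, sum_divisors_Stilde b hm]
end

section
/- Let R be a commutative ring with identity that is torsion-free as an additive group (n·r = 0 with n a positive integer implies r = 0). For r ∈ R and a positive integer n set S(r,n) = ∑_{d|n} μ(d)·r^{n/d}. Then for all r, s ∈ R and every positive integer n, S(r·s, n) = ∑_{lcm(i,j)=n} S(r,i)·S(s,j). -/
open Finset ArithmeticFunction

/-- `S(r,n) = ∑_{d|n} μ(d)·r^{n/d}`. -/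
def Spoly {R : Type*} [CommRing R] (r : R) (n : ℕ) : R :=
  ∑ d ∈ n.divisors, ((moebius d : ℤ) : R) * r ^ (n / d)

theorem Spoly_eq_sum_divisorsAntidiagonal {R : Type*} [CommRing R] (r : R) (n : ℕ) :
    Spoly r n = ∑ x ∈ n.divisorsAntidiagonal, ((moebius x.1 : ℤ) : R) * r ^ x.2 :=
  (Nat.sum_divisorsAntidiagonal fun d e => ((moebius d : ℤ) : R) * r ^ e).symm

theorem sum_divisors_Spoly {R : Type*} [CommRing R] (r : R) {n : ℕ} (hn : 0 < n) :
    ∑ d ∈ n.divisors, Spoly r d = r ^ n :=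
  sum_eq_iff_sum_mul_moebius_eq.mpr
    (fun m _ => (Spoly_eq_sum_divisorsAntidiagonal r m).symm) n hn

theorem filter_lcm_eq_lcmPairs {n d : ℕ} (hn : 0 < n) (hd : d ∣ n) :
    {p ∈ n.divisors ×ˢ n.divisors | Nat.lcm p.1 p.2 = d} = lcmPairs d := by
  have hd0 : d ≠ 0 := ne_zero_of_dvd_ne_zero hn.ne' hd
  ext ⟨i, j⟩
  simp only [lcmPairs, mem_filter, mem_product, Nat.mem_divisors]
  constructor
  · rintro ⟨-, rfl⟩
    exact ⟨⟨⟨Nat.dvd_lcm_left i j, hd0⟩, Nat.dvd_lcm_right i j, hd0⟩, rfl⟩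
  · rintro ⟨⟨⟨hi, -⟩, hj, -⟩, h⟩
    exact ⟨⟨⟨hi.trans hd, hn.ne'⟩, hj.trans hd, hn.ne'⟩, h⟩

/-- If `R` is a commutative ring that is torsion-free as an additive group, then for all
`r, s ∈ R` and every `n ≥ 1`, `S(r·s, n) = ∑_{lcm(i,j)=n} S(r,i)·S(s,j)`. -/
theorem Spoly_mul (R : Type*) [CommRing R]
    (htf : ∀ n : ℕ, 0 < n → ∀ r : R, n • r = 0 → r = 0)
    (r s : R) (n : ℕ) (hn : 0 < n) :
    Spoly (r * s) n = ∑ p ∈ lcmPairs n, Spoly r p.1 * Spoly s p.2 := by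
  rw [Spoly_eq_sum_divisorsAntidiagonal]
  refine sum_eq_iff_sum_mul_moebius_eq (R := R)
    (f := fun m => ∑ p ∈ lcmPairs m, Spoly r p.1 * Spoly s p.2) (g := fun m => (r * s) ^ m)
    |>.mp (fun m hm => ?_) n hn
  rw [sum_divisors_sum_lcmPairs _ _ hm, sum_divisors_Spoly r hm, sum_divisors_Spoly s hm, mul_pow]
end

section
/- There exists a family of polynomials s_n (n ≥ 1), each with integer coefficients in the variables q and x_d, y_d for d dividing n, such that for every positive integer n the identity ∑_{d|n} d·q^{n/d − 1}·s_d^{n/d} = ∑_{d|n} d·q^{n/d − 1}·x_d^{n/d} + ∑_{d|n} d·q^{n/d − 1}·y_d^{n/d} holds in the polynomial ring ℤ[q, x_1, x_2, …, y_1, y_2, …]. -/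
open Finset MvPolynomial

/-- Variables of the polynomial ring `ℤ[q, x₁, x₂, …, y₁, y₂, …]`. -/
abbrev WVar : Type := Unit ⊕ ℕ ⊕ ℕ

/-- The variable `q`. -/
def qVar : WVar := Sum.inl ()

/-- The variable `x_d`. -/
def xVar (d : ℕ) : WVar := Sum.inr (Sum.inl d)

/-- The variable `y_d`. -/
def yVar (d : ℕ) : WVar := Sum.inr (Sum.inr d)

/-- The `n`-th component of the `q`-ghost map, `∑_{d|n} d·q^{n/d−1}·a_d^{n/d}`. -/
def qGhost {R : Type*} [CommRing R] (q : R) (a : ℕ → R) (n : ℕ) : R :=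
  ∑ d ∈ n.divisors, (d : R) * q ^ (n / d - 1) * a d ^ (n / d)

section Ring

variable {R : Type*} [CommRing R]

lemma mul_qGhost (q : R) (a : ℕ → R) (n : ℕ) :
    q * qGhost q a n = ∑ d ∈ n.divisors, (d : R) * (q * a d) ^ (n / d) := by
  rw [qGhost, mul_sum]
  refine sum_congr rfl fun d hd => ?_
  have hpos : n / d ≠ 0 := (Nat.div_pos (Nat.divisor_le hd) (Nat.pos_of_mem_divisors hd)).ne'
  obtain ⟨m, hm⟩ := Nat.exists_eq_succ_of_ne_zero hpos
  rw [hm, Nat.succ_sub_one, Nat.succ_eq_add_one]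
  ring

lemma qGhost_eq_sum_properDivisors_add (q : R) (a : ℕ → R) {n : ℕ} (hn : 0 < n) :
    qGhost q a n =
      ∑ d ∈ n.properDivisors, (d : R) * q ^ (n / d - 1) * a d ^ (n / d) + n * a n := by
  rw [qGhost, ← Nat.cons_self_properDivisors hn.ne', sum_cons, add_comm]
  simp [Nat.div_self hn]

/-- If `a ≡ b` modulo `p` then `d·a^m ≡ d·b^m` modulo every power of `p` dividing `p·d·m`. -/
lemma prime_pow_dvd_mul_pow_sub_pow {p k d m : ℕ} (hp : p.Prime) (hm : m ≠ 0)
    (hk : p ^ k ∣ p * (d * m)) {a b : R} (hab : (p : R) ∣ a - b) :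
    (p : R) ^ k ∣ d * (a ^ m - b ^ m) := by
  obtain ⟨j, m', hpm', rfl⟩ := Nat.exists_eq_pow_mul_and_not_dvd hm p hp.ne_one
  have hdvd : p ^ k ∣ d * p ^ (j + 1) := by
    refine Nat.Coprime.dvd_of_dvd_mul_right (n := m') ?_ ?_
    · exact Nat.Coprime.pow_left _ ((Nat.Prime.coprime_iff_not_dvd hp).2 hpm')
    · convert hk using 1
      ring
  have hcast : (p : R) ^ k ∣ d * (p : R) ^ (j + 1) := by
    exact_mod_cast Nat.cast_dvd_cast (α := R) hdvd
  refine hcast.trans (mul_dvd_mul_left _ ((dvd_sub_pow_of_dvd_sub hab j).trans ?_))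
  rw [pow_mul, pow_mul]
  exact sub_dvd_pow_sub_pow _ _ _

/-- Dwork's congruence for the ghost components, relative to a Frobenius lift `φ`. -/
lemma prime_pow_dvd_ghost_sub_map {p k n : ℕ} (hp : p.Prime) (hn : 0 < n) (hpn : p ∣ n)
    (hk : p ^ k ∣ n) (φ : R →+* R) (hφ : ∀ a, (p : R) ∣ a ^ p - φ a) (a : ℕ → R) :
    (p : R) ^ k ∣ ∑ d ∈ n.divisors, (d : R) * a d ^ (n / d) -
      φ (∑ d ∈ (n / p).divisors, (d : R) * a d ^ (n / p / d)) := by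
  have hsub : (n / p).divisors ⊆ n.divisors :=
    Nat.divisors_subset_of_dvd hn.ne' (Nat.div_dvd_of_dvd hpn)
  rw [← sum_sdiff hsub, map_sum, add_sub_assoc, ← sum_sub_distrib]
  refine dvd_add (dvd_sum fun d hd => ?_) (dvd_sum fun d hd => ?_)
  · obtain ⟨hd, hd'⟩ := mem_sdiff.1 hd
    obtain ⟨m, rfl⟩ := Nat.dvd_of_mem_divisors hd
    have hpm : ¬ p ∣ m := by
      rintro ⟨c, rfl⟩
      refine hd' (Nat.mem_divisors.2 ⟨⟨c, ?_⟩, ?_⟩)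
      · rw [mul_left_comm, Nat.mul_div_cancel_left _ hp.pos]
      · exact (Nat.div_pos (Nat.le_of_dvd hn hpn) hp.pos).ne'
    have hdvd : p ^ k ∣ d := Nat.Coprime.dvd_of_dvd_mul_right
      (Nat.Coprime.pow_left _ ((Nat.Prime.coprime_iff_not_dvd hp).2 hpm)) hk
    exact Dvd.dvd.mul_right (by exact_mod_cast Nat.cast_dvd_cast (α := R) hdvd) _
  · obtain ⟨c, rfl⟩ := hpn
    rw [Nat.mul_div_cancel_left _ hp.pos] at hd ⊢
    obtain ⟨m, rfl⟩ := Nat.dvd_of_mem_divisors hd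
    have hd0 : 0 < d := Nat.pos_of_mem_divisors hd
    have hm0 : m ≠ 0 := by
      rintro rfl
      simp at hn
    rw [mul_left_comm, Nat.mul_div_cancel_left _ hd0, Nat.mul_div_cancel_left _ hd0, map_mul,
      map_natCast, map_pow, ← mul_sub, pow_mul]
    exact prime_pow_dvd_mul_pow_sub_pow hp hm0 hk (hφ _)

end Ring

section MvPolynomial

variable {σ : Type*}

lemma MvPolynomial.natCast_dvd_iff_dvd_coeff (n : ℕ) (f : MvPolynomial σ ℤ) :
    (n : MvPolynomial σ ℤ) ∣ f ↔ ∀ m, (n : ℤ) ∣ f.coeff m := by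
  rw [← C_dvd_iff_dvd_coeff, map_natCast]

lemma MvPolynomial.natCast_dvd_of_dvd_X_mul {n : ℕ} {i : σ} {f : MvPolynomial σ ℤ}
    (h : (n : MvPolynomial σ ℤ) ∣ X i * f) : (n : MvPolynomial σ ℤ) ∣ f := by
  rw [natCast_dvd_iff_dvd_coeff] at h ⊢
  intro m
  have hm := h (m + Finsupp.single i 1)
  rwa [mul_comm, coeff_mul_X] at hm

lemma MvPolynomial.natCast_dvd_of_prime_pow_dvd {n : ℕ} {f : MvPolynomial σ ℤ}
    (h : ∀ p k : ℕ, p.Prime → p ∣ n → p ^ k ∣ n → (p : MvPolynomial σ ℤ) ^ k ∣ f) :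
    (n : MvPolynomial σ ℤ) ∣ f := by
  rw [natCast_dvd_iff_dvd_coeff]
  intro m
  rw [Int.natCast_dvd, Nat.dvd_iff_prime_pow_dvd_dvd]
  intro p k hp hk
  rcases Nat.eq_zero_or_pos k with rfl | hk0
  · simp
  · have := h p k hp ((dvd_pow_self p hk0.ne').trans hk) hk
    rw [← Nat.cast_pow, natCast_dvd_iff_dvd_coeff] at this
    exact Int.natCast_dvd.1 (this m)

lemma MvPolynomial.prime_dvd_pow_sub_expand {p : ℕ} (hp : p.Prime) (f : MvPolynomial σ ℤ) :
    (p : MvPolynomial σ ℤ) ∣ f ^ p - expand p f := by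
  have : Fact p.Prime := ⟨hp⟩
  rw [← map_natCast (C : ℤ →+* MvPolynomial σ ℤ), C_dvd_iff_zmod, map_sub, map_pow, map_expand,
    expand_zmod, sub_self]

/-- The sequence with `q`-ghost components `b`, where `q = X i`, as long as the divisions it
requires are possible. -/
noncomputable def qGhostInv (i : σ) (b : ℕ → MvPolynomial σ ℤ) : ℕ → MvPolynomial σ ℤ
  | n =>
    open Classical in
    if h : (n : MvPolynomial σ ℤ) ∣ b n - ∑ d ∈ n.properDivisors.attach,
        (d.1 : MvPolynomial σ ℤ) * X i ^ (n / d.1 - 1) * qGhostInv i b d.1 ^ (n / d.1)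
    then h.choose else 0
decreasing_by all_goals exact (Nat.mem_properDivisors.1 d.2).2

lemma natCast_mul_qGhostInv (i : σ) (b : ℕ → MvPolynomial σ ℤ) (n : ℕ)
    (h : (n : MvPolynomial σ ℤ) ∣ b n - ∑ d ∈ n.properDivisors,
      (d : MvPolynomial σ ℤ) * X i ^ (n / d - 1) * qGhostInv i b d ^ (n / d)) :
    (n : MvPolynomial σ ℤ) * qGhostInv i b n = b n - ∑ d ∈ n.properDivisors,
      (d : MvPolynomial σ ℤ) * X i ^ (n / d - 1) * qGhostInv i b d ^ (n / d) := by
  rw [← sum_attach] at h ⊢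
  rw [qGhostInv, dif_pos h]
  exact h.choose_spec.symm

/-- Dwork's lemma for the `q`-ghost map. -/
lemma qGhost_qGhostInv (i : σ) (b : ℕ → MvPolynomial σ ℤ)
    (hb : ∀ n p k : ℕ, 0 < n → p.Prime → p ∣ n → p ^ k ∣ n →
      (p : MvPolynomial σ ℤ) ^ k ∣ X i * b n - expand p (X i * b (n / p)))
    (n : ℕ) (hn : 0 < n) : qGhost (X i) (qGhostInv i b) n = b n := by
  induction n using Nat.strong_induction_on with
  | _ n ih =>
    rw [qGhost_eq_sum_properDivisors_add _ _ hn, natCast_mul_qGhostInv, add_sub_cancel]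
    set a : ℕ → MvPolynomial σ ℤ := fun d => if d < n then qGhostInv i b d else 0 with ha
    have hsum : ∑ d ∈ n.properDivisors,
        (d : MvPolynomial σ ℤ) * X i ^ (n / d - 1) * qGhostInv i b d ^ (n / d) =
          qGhost (X i) a n := by
      rw [qGhost_eq_sum_properDivisors_add _ _ hn]
      simp only [ha, lt_irrefl, if_false, mul_zero, add_zero]
      refine sum_congr rfl fun d hd => ?_
      rw [if_pos (Nat.mem_properDivisors.1 hd).2]
    rw [hsum]
    refine natCast_dvd_of_dvd_X_mul (i := i)
      (natCast_dvd_of_prime_pow_dvd fun p k hp hpn hk => ?_)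
    have hlt : n / p < n := Nat.div_lt_self hn hp.one_lt
    have hprev : qGhost (X i) a (n / p) = b (n / p) := by
      rw [← ih _ hlt (Nat.div_pos (Nat.le_of_dvd hn hpn) hp.pos), qGhost, qGhost]
      refine sum_congr rfl fun d hd => ?_
      simp only [ha, if_pos ((Nat.divisor_le hd).trans_lt hlt)]
    have hcong := prime_pow_dvd_ghost_sub_map hp hn hpn hk
      (expand p : MvPolynomial σ ℤ →ₐ[ℤ] MvPolynomial σ ℤ).toRingHom
      (prime_dvd_pow_sub_expand hp) (fun d => X i * a d)
    rw [← mul_qGhost, ← mul_qGhost, hprev] at hcong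
    have := dvd_sub (hb n p k hn hp hpn hk) hcong
    rwa [AlgHom.toRingHom_eq_coe, RingHom.coe_coe, sub_sub_sub_cancel_right, ← mul_sub] at this

lemma prime_pow_dvd_X_mul_qGhost_sub_expand (i : σ) (a : ℕ → MvPolynomial σ ℤ) {n p k : ℕ}
    (hn : 0 < n) (hp : p.Prime) (hpn : p ∣ n) (hk : p ^ k ∣ n) :
    (p : MvPolynomial σ ℤ) ^ k ∣
      X i * qGhost (X i) a n - expand p (X i * qGhost (X i) a (n / p)) := by
  rw [mul_qGhost, mul_qGhost]
  exact prime_pow_dvd_ghost_sub_map hp hn hpn hk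
    (expand p : MvPolynomial σ ℤ →ₐ[ℤ] MvPolynomial σ ℤ).toRingHom
    (prime_dvd_pow_sub_expand hp) (fun d => X i * a d)

lemma qGhost_mem (A : Subalgebra ℤ (MvPolynomial σ ℤ)) {q : MvPolynomial σ ℤ} (hq : q ∈ A)
    {a : ℕ → MvPolynomial σ ℤ} {n : ℕ} (ha : ∀ d, d ∣ n → a d ∈ A) : qGhost q a n ∈ A :=
  sum_mem fun d hd => mul_mem (mul_mem (natCast_mem A d) (pow_mem hq _))
    (pow_mem (ha d (Nat.dvd_of_mem_divisors hd)) _)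

lemma MvPolynomial.mem_supported_of_natCast_mul_mem {s : Set σ} {n : ℕ} (hn : 0 < n)
    {f : MvPolynomial σ ℤ} (h : (n : MvPolynomial σ ℤ) * f ∈ supported ℤ s) :
    f ∈ supported ℤ s := by
  rw [mem_supported] at h ⊢
  rwa [← map_natCast (C : ℤ →+* MvPolynomial σ ℤ), vars_C_mul _ (by exact_mod_cast hn.ne')] at h

/-- If the `q`-ghost components of `a` only involve the variables in `s n`, then so does `a`. -/
lemma mem_supported_of_qGhost_mem {i : σ} {s : ℕ → Set σ} (hi : ∀ n, i ∈ s n)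
    (hs : ∀ d n, d ∣ n → s d ⊆ s n) {a : ℕ → MvPolynomial σ ℤ}
    (h : ∀ n, 0 < n → qGhost (X i) a n ∈ supported ℤ (s n)) (n : ℕ) (hn : 0 < n) :
    a n ∈ supported ℤ (s n) := by
  induction n using Nat.strong_induction_on with
  | _ n ih =>
    refine mem_supported_of_natCast_mul_mem hn ?_
    rw [← sub_eq_of_eq_add' (qGhost_eq_sum_properDivisors_add (X i) a hn)]
    refine sub_mem (h n hn) (sum_mem fun d hd => ?_)
    obtain ⟨hdn, hlt⟩ := Nat.mem_properDivisors.1 hd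
    exact mul_mem (mul_mem (natCast_mem _ d) (pow_mem (X_mem_supported.2 (hi n)) _))
      (pow_mem (supported_mono (hs d n hdn) (ih d hlt (Nat.pos_of_dvd_of_pos hdn hn))) _)

end MvPolynomial

/-- There is a family of integral polynomials `s_n` in `q` and the `x_d, y_d` for `d ∣ n`
such that `∑_{d|n} d·q^{n/d−1}·s_d^{n/d}
  = ∑_{d|n} d·q^{n/d−1}·x_d^{n/d} + ∑_{d|n} d·q^{n/d−1}·y_d^{n/d}`
for every `n ≥ 1`: the addition polynomials of the `q`-deformed Witt ring. -/
theorem qWitt_addition_polynomials :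
    ∃ s : ℕ → MvPolynomial WVar ℤ,
      (∀ n : ℕ, 0 < n → ∀ v ∈ (s n).vars,
        v = qVar ∨ ∃ d : ℕ, d ∣ n ∧ (v = xVar d ∨ v = yVar d)) ∧
      (∀ n : ℕ, 0 < n →
        ∑ d ∈ n.divisors, C (d : ℤ) * X qVar ^ (n / d - 1) * s d ^ (n / d)
          = (∑ d ∈ n.divisors, C (d : ℤ) * X qVar ^ (n / d - 1) * X (xVar d) ^ (n / d))
            + ∑ d ∈ n.divisors, C (d : ℤ) * X qVar ^ (n / d - 1) * X (yVar d) ^ (n / d)) := by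
  set b : ℕ → MvPolynomial WVar ℤ := fun n =>
    qGhost (X qVar) (fun d => X (xVar d)) n + qGhost (X qVar) (fun d => X (yVar d)) n with hb
  have hghost : ∀ n, 0 < n → qGhost (X qVar) (qGhostInv qVar b) n = b n := by
    refine qGhost_qGhostInv qVar b fun n p k hn hp hpn hk => ?_
    simp only [hb, mul_add, map_add, add_sub_add_comm]
    exact dvd_add (prime_pow_dvd_X_mul_qGhost_sub_expand _ _ hn hp hpn hk)
      (prime_pow_dvd_X_mul_qGhost_sub_expand _ _ hn hp hpn hk)
  refine ⟨qGhostInv qVar b, fun n hn v hv => ?_, fun n hn => ?_⟩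
  · have hmem := mem_supported_of_qGhost_mem (i := qVar)
      (s := fun n => {v | v = qVar ∨ ∃ d : ℕ, d ∣ n ∧ (v = xVar d ∨ v = yVar d)})
      (fun _ => Or.inl rfl)
      (fun _ _ hdn _ => Or.imp_right fun ⟨e, he, hv⟩ => ⟨e, he.trans hdn, hv⟩)
      (a := qGhostInv qVar b) (fun m hm => ?_) n hn
    · exact mem_supported.1 hmem hv
    · rw [hghost m hm]
      refine add_mem (qGhost_mem _ ?_ fun d hd => ?_) (qGhost_mem _ ?_ fun d hd => ?_)
      · exact X_mem_supported.2 (Or.inl rfl)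
      · exact X_mem_supported.2 (Or.inr ⟨d, hd, Or.inl rfl⟩)
      · exact X_mem_supported.2 (Or.inl rfl)
      · exact X_mem_supported.2 (Or.inr ⟨d, hd, Or.inr rfl⟩)
  · simpa only [hb, qGhost, map_natCast] using hghost n hn
end

section
/- Let R be a commutative ring with identity that is torsion-free as an additive group (n·r = 0 with n a positive integer implies r = 0) and satisfies a^p ≡ a (mod pR) for every prime p and every a ∈ R. Then for every r ∈ R and every positive integer n, the element ∑_{d|n} μ(d)·r^{n/d} lies in n·R; that is, there exists m ∈ R with ∑_{d|n} μ(d)·r^{n/d} = n·m. -/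
open Finset ArithmeticFunction

theorem natCast_dvd_of_forall_prime_pow_dvd {R : Type*} [CommRing R] {x : R} (n : ℕ)
    (hn : n ≠ 0) (h : ∀ p k : ℕ, p.Prime → p ^ k ∣ n → ((p ^ k : ℕ) : R) ∣ x) :
    (n : R) ∣ x := by
  induction n using Nat.recOnPosPrimePosCoprime with
  | prime_pow p k hp _ => exact h p k hp dvd_rfl
  | zero => exact absurd rfl hn
  | one => simp
  | coprime a b ha hb hab iha ihb =>
    rw [Nat.cast_mul]
    exact (Nat.Coprime.cast hab).mul_dvd
      (iha (by lia) fun p k hp hk => h p k hp (hk.mul_right b))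
      (ihb (by lia) fun p k hp hk => h p k hp (hk.mul_left a))

theorem sum_moebius_mul_pow_div_eq_of_coprime {R : Type*} [CommRing R] (r : R)
    {p k m : ℕ} (hp : p.Prime) (hpm : p.Coprime m) :
    ∑ d ∈ (p ^ (k + 1) * m).divisors, ((moebius d : ℤ) : R) * r ^ (p ^ (k + 1) * m / d) =
      ∑ d ∈ m.divisors, ((moebius d : ℤ) : R) *
        (((r ^ (m / d)) ^ p) ^ p ^ k - (r ^ (m / d)) ^ p ^ k) := by
  have hc : (p ^ (k + 1)).Coprime m := hpm.pow_left _
  rw [Nat.divisors_mul, mul_def, sum_image (by simpa using hc.mul_injOn_divisors),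
    sum_product_right]
  refine sum_congr rfl fun d hd => ?_
  have hdm : d ∣ m := Nat.dvd_of_mem_divisors hd
  have hpd : p.Coprime d := hpm.coprime_dvd_right hdm
  have hdiv (i : ℕ) (hi : i ≤ k + 1) :
      p ^ (k + 1) * m / (p ^ i * d) = p ^ (k + 1 - i) * (m / d) := by
    rw [Nat.mul_div_mul_comm (pow_dvd_pow p hi) hdm, Nat.pow_div hi hp.pos]
  have hmu (i : ℕ) : moebius (p ^ i * d) = moebius (p ^ i) * moebius d :=
    isMultiplicative_moebius.map_mul_of_coprime (hpd.pow_left i)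
  rw [Nat.sum_divisors_prime_pow hp, sum_range_succ', sum_range_succ', sum_eq_zero, zero_add]
  · rw [hdiv _ (by lia), hdiv _ (by lia), hmu, hmu]
    simp only [zero_add, pow_one, pow_zero, moebius_apply_prime hp, moebius_apply_one,
      Nat.add_sub_cancel, Nat.sub_zero, ← pow_mul]
    push_cast
    ring
  · intro i _
    rw [hmu, moebius_apply_prime_pow hp (by lia)]
    simp

/-- Let `R` be a commutative ring, torsion-free as an additive group, with
`a^p ≡ a (mod pR)` for every prime `p` and every `a ∈ R`. Then for every `r ∈ R` and every
`n ≥ 1`, the element `∑_{d|n} μ(d)·r^{n/d}` lies in `n·R`. -/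
theorem moebius_sum_mem_nR (R : Type*) [CommRing R]
    (htf : ∀ n : ℕ, 0 < n → ∀ r : R, n • r = 0 → r = 0)
    (hfrob : ∀ p : ℕ, p.Prime → ∀ a : R, ∃ b : R, a ^ p - a = (p : R) * b)
    (r : R) (n : ℕ) (hn : 0 < n) :
    ∃ m : R, ∑ d ∈ n.divisors, ((moebius d : ℤ) : R) * r ^ (n / d) = (n : R) * m := by
  refine natCast_dvd_of_forall_prime_pow_dvd n hn.ne' fun p j hp hj => ?_
  obtain ⟨e, m, hpm, rfl⟩ := Nat.exists_eq_pow_mul_and_not_dvd hn.ne' p hp.ne_one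
  have hc : p.Coprime m := (Nat.Prime.coprime_iff_not_dvd hp).2 hpm
  have hje : p ^ j ∣ p ^ e := (hc.pow_left j).dvd_of_dvd_mul_right hj
  refine (Nat.cast_dvd_cast hje).trans ?_
  cases e with
  | zero => simp
  | succ k =>
    rw [sum_moebius_mul_pow_div_eq_of_coprime r hp hc]
    refine dvd_sum fun d _ => Dvd.dvd.mul_left ?_ _
    rw [Nat.cast_pow]
    exact dvd_sub_pow_of_dvd_sub (hfrob p hp _) k
end
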